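/- arXiv:2112.00882 — 8 statements merged into one kernel-verified Lean document; each statement's English description precedes it below -/
import Mathlib

section
/- The OS-GPTD mean update can be rewritten in preconditioned-gradient form: for every t ≥ 1, θ̂_t = θ̂_{t-1} − (1/(2σ_n²)) Σ_t ∇_t, where ∇_t = 2 h_t (h_tᵀ θ̂_{t-1} − r_t) is the gradient of the instantaneous Bellman error l_t(θ) = (r_t − h_tᵀ θ)² evaluated at θ̂_{t-1}. -/
open Matrix Finset

section RankOneDowndate

variable {ι : Type*} [Fintype ι]

/-- The posterior covariance update of a scalar observation preserves symmetry,
whatever the scaling factor `c`. -/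
lemma Matrix.IsSymm.sub_smul_vecMulVec_mulVec {A : Matrix ι ι ℝ} (hA : A.IsSymm)
    (c : ℝ) (h : ι → ℝ) : (A - c • vecMulVec (A *ᵥ h) (h ᵥ* A)).IsSymm := by
  have hu : h ᵥ* A = A *ᵥ h := by rw [← mulVec_transpose, hA.eq]
  rw [Matrix.IsSymm, transpose_sub, transpose_smul, transpose_vecMulVec, hA.eq, hu]

/-- The posterior covariance update of a scalar observation `hᵀ θ + noise`, with noise variance
`v > 0`, preserves nonnegativity of the quadratic form. -/
lemma dotProduct_mulVec_rankOneDowndate_nonneg {A : Matrix ι ι ℝ} (hA : A.IsSymm)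
    (hpos : ∀ x, 0 ≤ x ⬝ᵥ A *ᵥ x) {v : ℝ} (hv : 0 < v) (h x : ι → ℝ) :
    0 ≤ x ⬝ᵥ (A - (h ⬝ᵥ A *ᵥ h + v)⁻¹ • vecMulVec (A *ᵥ h) (h ᵥ* A)) *ᵥ x := by
  have hD : 0 < h ⬝ᵥ A *ᵥ h + v := add_pos_of_nonneg_of_pos (hpos h) hv
  have hsymm : h ⬝ᵥ A *ᵥ x = x ⬝ᵥ A *ᵥ h := by
    rw [dotProduct_mulVec, ← mulVec_transpose, hA.eq, dotProduct_comm]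
  set b := x ⬝ᵥ A *ᵥ h with hb
  set D := h ⬝ᵥ A *ᵥ h + v with hD'
  have hquad : x ⬝ᵥ (A - D⁻¹ • vecMulVec (A *ᵥ h) (h ᵥ* A)) *ᵥ x =
      x ⬝ᵥ A *ᵥ x - D⁻¹ * b ^ 2 := by
    simp only [sub_mulVec, smul_mulVec, vecMulVec_mulVec, dotProduct_sub, dotProduct_smul,
      ← dotProduct_mulVec, hsymm, smul_eq_mul, op_smul_eq_smul, ← hb]
    ring
  have hsq : (x - (b / D) • h) ⬝ᵥ A *ᵥ (x - (b / D) • h) + v * (b / D) ^ 2 =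
      x ⬝ᵥ A *ᵥ x - D⁻¹ * b ^ 2 := by
    have ha : h ⬝ᵥ A *ᵥ h = D - v := by rw [hD']; ring
    simp only [mulVec_sub, mulVec_smul, dotProduct_sub, sub_dotProduct, dotProduct_smul,
      smul_dotProduct, smul_eq_mul, hsymm, ← hb, ha]
    field_simp
    ring
  rw [hquad, ← hsq]
  exact add_nonneg (hpos _) (by positivity)

/-- The gain identity: the updated covariance maps `h` to a multiple of `A *ᵥ h`. -/
lemma rankOneDowndate_mulVec_self (A : Matrix ι ι ℝ) (h : ι → ℝ) {v : ℝ}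
    (hD : h ⬝ᵥ A *ᵥ h + v ≠ 0) :
    (A - (h ⬝ᵥ A *ᵥ h + v)⁻¹ • vecMulVec (A *ᵥ h) (h ᵥ* A)) *ᵥ h =
      (v / (h ⬝ᵥ A *ᵥ h + v)) • A *ᵥ h := by
  simp only [sub_mulVec, smul_mulVec, vecMulVec_mulVec, ← dotProduct_mulVec, op_smul_eq_smul]
  rw [smul_smul]
  nth_rewrite 1 [← one_smul ℝ (A *ᵥ h)]
  rw [← sub_smul]
  congr 1
  field_simp
  ring

end RankOneDowndate

/-- The OS-GPTD mean update in preconditioned-gradient form: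
`θ̂_t = θ̂_{t-1} − (1/(2σ_n²)) Σ_t ∇_t` with `∇_t = 2 h_t (h_tᵀ θ̂_{t-1} − r_t)`. -/
theorem osgptd_preconditioned_gradient_form
    (n : ℕ) (hn : 1 ≤ n) (σθ σn : ℝ) (hσθ : 0 < σθ) (hσn : 0 < σn)
    (h : ℕ → Fin n → ℝ) (r : ℕ → ℝ)
    (θ : ℕ → Fin n → ℝ) (S : ℕ → Matrix (Fin n) (Fin n) ℝ)
    (hθ0 : θ 0 = 0)
    (hS0 : S 0 = σθ ^ 2 • (1 : Matrix (Fin n) (Fin n) ℝ))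
    (hθrec : ∀ t : ℕ, θ (t + 1) = θ t +
      ((r (t + 1) - h (t + 1) ⬝ᵥ θ t) / (h (t + 1) ⬝ᵥ S t *ᵥ h (t + 1) + σn ^ 2)) •
        (S t *ᵥ h (t + 1)))
    (hSrec : ∀ t : ℕ, S (t + 1) = S t -
      (h (t + 1) ⬝ᵥ S t *ᵥ h (t + 1) + σn ^ 2)⁻¹ •
        vecMulVec (S t *ᵥ h (t + 1)) (h (t + 1) ᵥ* S t)) :
    ∀ t : ℕ, θ (t + 1) = θ t -
      (1 / (2 * σn ^ 2)) •
        (S (t + 1) *ᵥ ((2 * (h (t + 1) ⬝ᵥ θ t - r (t + 1))) • h (t + 1))) := by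
  intro t
  have hS : ∀ t, (S t).IsSymm ∧ ∀ x, 0 ≤ x ⬝ᵥ S t *ᵥ x := by
    intro t
    induction t with
    | zero =>
      rw [hS0]
      refine ⟨isSymm_one.smul _, fun x => ?_⟩
      rw [smul_mulVec, one_mulVec, dotProduct_smul, smul_eq_mul]
      exact mul_nonneg (sq_nonneg _) (Finset.sum_nonneg fun i _ => mul_self_nonneg (x i))
    | succ t ih =>
      rw [hSrec t]
      exact ⟨ih.1.sub_smul_vecMulVec_mulVec _ _,
        dotProduct_mulVec_rankOneDowndate_nonneg ih.1 ih.2 (by positivity) _⟩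
  have hD : h (t + 1) ⬝ᵥ S t *ᵥ h (t + 1) + σn ^ 2 ≠ 0 :=
    (add_pos_of_nonneg_of_pos ((hS t).2 _) (by positivity)).ne'
  rw [hθrec t, mulVec_smul, hSrec t, rankOneDowndate_mulVec_self _ _ hD, smul_smul, smul_smul,
    sub_eq_add_neg (θ t), ← neg_smul]
  congr 2
  field_simp
  ring
end

section
/- For every t ≥ 1 and every θ* ∈ ℝⁿ, the OS-GPTD iterates satisfy the exact quadratic-form expansion (θ* − θ̂_t)ᵀ J_t (θ* − θ̂_t) = (θ* − θ̂_{t-1})ᵀ J_t (θ* − θ̂_{t-1}) + σ_n⁻² ∇_tᵀ (θ* − θ̂_{t-1}) + (1/(4σ_n⁴)) ∇_tᵀ J_t⁻¹ ∇_t, where J_t = Σ_t⁻¹ and ∇_t = 2 h_t (h_tᵀ θ̂_{t-1} − r_t). -/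
open Matrix Finset

section RankOne

variable {m : Type*} [Fintype m]

theorem Matrix.IsSymm.dotProduct_mulVec_comm {A : Matrix m m ℝ} (hA : A.IsSymm) (x y : m → ℝ) :
    x ⬝ᵥ A *ᵥ y = y ⬝ᵥ A *ᵥ x := by
  rw [dotProduct_mulVec, ← mulVec_transpose, hA.eq, dotProduct_comm]

/-- The rank-one covariance downdate of a Kalman filter with scalar observations of noise
variance `s` along `v`. -/
noncomputable def covarianceDowndate (A : Matrix m m ℝ) (v : m → ℝ) (s : ℝ) : Matrix m m ℝ :=
  A - (v ⬝ᵥ A *ᵥ v + s)⁻¹ • vecMulVec (A *ᵥ v) (v ᵥ* A)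

theorem covarianceDowndate_mulVec (A : Matrix m m ℝ) (v : m → ℝ) (s : ℝ) (x : m → ℝ) :
    covarianceDowndate A v s *ᵥ x =
      A *ᵥ x - ((v ⬝ᵥ A *ᵥ v + s)⁻¹ * (v ⬝ᵥ A *ᵥ x)) • A *ᵥ v := by
  rw [covarianceDowndate, sub_mulVec, smul_mulVec, vecMulVec_mulVec, ← dotProduct_mulVec,
    op_smul_eq_smul, smul_smul]

theorem covarianceDowndate_isSymm {A : Matrix m m ℝ} (hA : A.IsSymm) (v : m → ℝ) (s : ℝ) :
    (covarianceDowndate A v s).IsSymm := by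
  have hv : v ᵥ* A = A *ᵥ v := by rw [← mulVec_transpose, hA.eq]
  rw [Matrix.IsSymm, covarianceDowndate, transpose_sub, transpose_smul, transpose_vecMulVec, hv,
    hA.eq]

theorem covarianceDowndate_nonneg {A : Matrix m m ℝ} (hA : A.IsSymm)
    (hA0 : ∀ x, 0 ≤ x ⬝ᵥ A *ᵥ x) (v : m → ℝ) {s : ℝ} (hs : 0 < s) (x : m → ℝ) :
    0 ≤ x ⬝ᵥ covarianceDowndate A v s *ᵥ x := by
  have hD : v ⬝ᵥ A *ᵥ v + s ≠ 0 := (add_pos_of_nonneg_of_pos (hA0 v) hs).ne'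
  set c := (x ⬝ᵥ A *ᵥ v) / (v ⬝ᵥ A *ᵥ v + s) with hc
  have joseph : x ⬝ᵥ covarianceDowndate A v s *ᵥ x =
      (x - c • v) ⬝ᵥ A *ᵥ (x - c • v) + s * c ^ 2 := by
    simp only [covarianceDowndate_mulVec, mulVec_sub, mulVec_smul, sub_dotProduct, dotProduct_sub,
      smul_dotProduct, dotProduct_smul, smul_eq_mul, hA.dotProduct_mulVec_comm v x, hc]
    field_simp
    ring
  rw [joseph]
  have := hA0 (x - c • v)
  positivity

theorem covarianceDowndate_mulVec_self {A : Matrix m m ℝ} {v : m → ℝ} {s : ℝ}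
    (hD : v ⬝ᵥ A *ᵥ v + s ≠ 0) :
    covarianceDowndate A v s *ᵥ v = (s / (v ⬝ᵥ A *ᵥ v + s)) • A *ᵥ v := by
  rw [covarianceDowndate_mulVec]
  nth_rewrite 1 [← one_smul ℝ (A *ᵥ v)]
  rw [← sub_smul]
  congr 1
  field_simp
  ring

/-- Expansion of the quadratic form of `P⁻¹` along a step in the direction `P *ᵥ v`. -/
theorem Matrix.IsSymm.inv_quadratic_sub_smul_mulVec [DecidableEq m] {P : Matrix m m ℝ}
    (hP : P.IsSymm) (hu : IsUnit P) (d v : m → ℝ) (c : ℝ) :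
    (d - c • P *ᵥ v) ⬝ᵥ P⁻¹ *ᵥ (d - c • P *ᵥ v) =
      d ⬝ᵥ P⁻¹ *ᵥ d - 2 * c * (v ⬝ᵥ d) + c ^ 2 * (v ⬝ᵥ P *ᵥ v) := by
  have hdet : IsUnit P.det := (isUnit_iff_isUnit_det P).mp hu
  have hPinv : (P⁻¹).IsSymm := by rw [Matrix.IsSymm, transpose_nonsing_inv, hP.eq]
  have hJ : P⁻¹ *ᵥ (P *ᵥ v) = v := by rw [mulVec_mulVec, nonsing_inv_mul _ hdet, one_mulVec]
  simp only [mulVec_sub, mulVec_smul, sub_dotProduct, dotProduct_sub, smul_dotProduct,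
    dotProduct_smul, smul_eq_mul, hJ, hPinv.dotProduct_mulVec_comm (P *ᵥ v) d,
    dotProduct_comm d v, dotProduct_comm (P *ᵥ v) v]
  ring

end RankOne

/-- Exact quadratic-form expansion for the OS-GPTD iterates:
`(θ*−θ̂_t)ᵀ J_t (θ*−θ̂_t) = (θ*−θ̂_{t-1})ᵀ J_t (θ*−θ̂_{t-1}) + σ_n⁻² ∇_tᵀ(θ*−θ̂_{t-1})
  + (1/(4σ_n⁴)) ∇_tᵀ J_t⁻¹ ∇_t`, where `J_t = Σ_t⁻¹`. -/
theorem osgptd_quadratic_form_expansion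
    (n : ℕ) (hn : 1 ≤ n) (σθ σn : ℝ) (hσθ : 0 < σθ) (hσn : 0 < σn)
    (h : ℕ → Fin n → ℝ) (r : ℕ → ℝ)
    (θ : ℕ → Fin n → ℝ) (S : ℕ → Matrix (Fin n) (Fin n) ℝ)
    (hθ0 : θ 0 = 0)
    (hS0 : S 0 = σθ ^ 2 • (1 : Matrix (Fin n) (Fin n) ℝ))
    (hθrec : ∀ t : ℕ, θ (t + 1) = θ t +
      ((r (t + 1) - h (t + 1) ⬝ᵥ θ t) / (h (t + 1) ⬝ᵥ S t *ᵥ h (t + 1) + σn ^ 2)) •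
        (S t *ᵥ h (t + 1)))
    (hSrec : ∀ t : ℕ, S (t + 1) = S t -
      (h (t + 1) ⬝ᵥ S t *ᵥ h (t + 1) + σn ^ 2)⁻¹ •
        vecMulVec (S t *ᵥ h (t + 1)) (h (t + 1) ᵥ* S t))
    (hSinv : ∀ t : ℕ, IsUnit (S t)) :
    ∀ t : ℕ, ∀ θs : Fin n → ℝ,
      (θs - θ (t + 1)) ⬝ᵥ (S (t + 1))⁻¹ *ᵥ (θs - θ (t + 1)) =
        (θs - θ t) ⬝ᵥ (S (t + 1))⁻¹ *ᵥ (θs - θ t)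
        + (σn ^ 2)⁻¹ * (((2 * (h (t + 1) ⬝ᵥ θ t - r (t + 1))) • h (t + 1)) ⬝ᵥ (θs - θ t))
        + (1 / (4 * σn ^ 4)) *
          (((2 * (h (t + 1) ⬝ᵥ θ t - r (t + 1))) • h (t + 1)) ⬝ᵥ
            ((S (t + 1))⁻¹)⁻¹ *ᵥ ((2 * (h (t + 1) ⬝ᵥ θ t - r (t + 1))) • h (t + 1))) := by
  have hs : 0 < σn ^ 2 := by positivity
  have hrec : ∀ t, S (t + 1) = covarianceDowndate (S t) (h (t + 1)) (σn ^ 2) := hSrec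
  have hS : ∀ t, (S t).IsSymm ∧ ∀ x, 0 ≤ x ⬝ᵥ S t *ᵥ x := by
    intro t
    induction t with
    | zero =>
      rw [hS0]
      refine ⟨by rw [Matrix.IsSymm, transpose_smul, transpose_one], fun x => ?_⟩
      rw [smul_mulVec, one_mulVec, dotProduct_smul, smul_eq_mul]
      exact mul_nonneg (sq_nonneg _) (Finset.sum_nonneg fun i _ => mul_self_nonneg (x i))
    | succ t ih =>
      rw [hrec]
      exact ⟨covarianceDowndate_isSymm ih.1 _ _, covarianceDowndate_nonneg ih.1 ih.2 _ hs⟩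
  intro t θs
  have hD : h (t + 1) ⬝ᵥ S t *ᵥ h (t + 1) + σn ^ 2 ≠ 0 :=
    (add_pos_of_nonneg_of_pos ((hS t).2 _) hs).ne'
  have hstep : θs - θ (t + 1) = (θs - θ t) -
      ((r (t + 1) - h (t + 1) ⬝ᵥ θ t) / σn ^ 2) • S (t + 1) *ᵥ h (t + 1) := by
    rw [hrec, covarianceDowndate_mulVec_self hD, smul_smul, div_mul_div_cancel₀ hs.ne', hθrec,
      sub_sub]
  rw [hstep, (hS (t + 1)).1.inv_quadratic_sub_smul_mulVec (hSinv (t + 1)),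
    nonsing_inv_nonsing_inv _ ((isUnit_iff_isUnit_det _).mp (hSinv (t + 1)))]
  simp only [mulVec_smul, smul_dotProduct, dotProduct_smul, smul_eq_mul]
  field_simp
  ring
end

section
/- Suppose γ ≥ 0 and ‖h_t‖ ≤ 1 + γ for t = 1, …, T. Then the information matrices J_t = σ_θ⁻² I_n + σ_n⁻² Σ_{τ=1}^t h_τ h_τᵀ satisfy the elliptical-potential bound Σ_{t=1}^T h_tᵀ J_t⁻¹ h_t ≤ n σ_n² log((1+γ)² σ_θ² T/σ_n² + 1). -/
open Matrix Finset

namespace Matrix.PosDef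

variable {ι : Type*} [Fintype ι] [DecidableEq ι]

lemma log_det_le_of_trace_le {M : Matrix ι ι ℝ} (hM : M.PosDef) {m : ℝ} (hm : 0 < m)
    (htr : M.trace ≤ Fintype.card ι * m) :
    Real.log M.det ≤ Fintype.card ι * Real.log m := by
  have hpos := hM.eigenvalues_pos
  have hdet : M.det = ∏ i, hM.isHermitian.eigenvalues i := by
    simpa using hM.isHermitian.det_eq_prod_eigenvalues
  have htrace : M.trace = ∑ i, hM.isHermitian.eigenvalues i := by
    simpa using hM.isHermitian.trace_eq_sum_eigenvalues
  rw [hdet, Real.log_prod fun i _ ↦ (hpos i).ne']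
  calc ∑ i, Real.log (hM.isHermitian.eigenvalues i)
      ≤ ∑ i, (hM.isHermitian.eigenvalues i / m - 1 + Real.log m) := by
        refine sum_le_sum fun i _ ↦ ?_
        have := Real.log_le_sub_one_of_pos (div_pos (hpos i) hm)
        rw [Real.log_div (hpos i).ne' hm.ne'] at this
        linarith
    _ = M.trace / m - Fintype.card ι + Fintype.card ι * Real.log m := by
        simp [sum_add_distrib, sum_sub_distrib, ← sum_div, htrace]
    _ ≤ Fintype.card ι * Real.log m := by
        have := (div_le_iff₀ hm).2 htr
        linarith

lemma mul_dotProduct_inv_mulVec_le_log_det_sub {A B : Matrix ι ι ℝ} (hA : A.PosDef)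
    (hB : B.PosDef) {c : ℝ} {v : ι → ℝ} (hAB : B = A + c • vecMulVec v v) :
    c * (v ⬝ᵥ B⁻¹ *ᵥ v) ≤ Real.log B.det - Real.log A.det := by
  have hdet : A.det = B.det * (1 - c * (v ⬝ᵥ B⁻¹ *ᵥ v)) := by
    have hA_eq : A = B + replicateCol Unit (-c • v) * replicateRow Unit v := by
      rw [← vecMulVec_eq, smul_vecMulVec, hAB]
      simp
    rw [hA_eq, det_add_replicateCol_mul_replicateRow (isUnit_iff_isUnit_det _ |>.1 hB.isUnit)]
    congr 1
    rw [Matrix.mul_assoc, ← replicateCol_mulVec, det_unique]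
    simp [Matrix.mul_apply, dotProduct, mulVec_neg, mulVec_smul, mul_sum, sub_eq_add_neg,
      mul_left_comm]
  have hpos : 0 < 1 - c * (v ⬝ᵥ B⁻¹ *ᵥ v) :=
    pos_of_mul_pos_right (hdet ▸ hA.det_pos) hB.det_pos.le
  rw [hdet, Real.log_mul hB.det_pos.ne' hpos.ne']
  linarith [Real.log_le_sub_one_of_pos hpos]

end Matrix.PosDef

/-- Elliptical-potential bound: with
`J_t = σ_θ⁻² I + σ_n⁻² ∑_{τ=1}^t h_τ h_τᵀ` and `‖h_t‖ ≤ 1 + γ`,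
`∑_{t=1}^T h_tᵀ J_t⁻¹ h_t ≤ n σ_n² log((1+γ)² σ_θ² T/σ_n² + 1)`. -/
theorem elliptical_potential_bound
    (n : ℕ) (hn : 1 ≤ n) (T : ℕ) (hT : 1 ≤ T)
    (σθ σn γ : ℝ) (hσθ : 0 < σθ) (hσn : 0 < σn) (hγ : 0 ≤ γ)
    (h : ℕ → Fin n → ℝ)
    (hnorm : ∀ t ∈ Finset.Icc 1 T, Real.sqrt (h t ⬝ᵥ h t) ≤ 1 + γ)
    (J : ℕ → Matrix (Fin n) (Fin n) ℝ)
    (hJ : ∀ t : ℕ, J t = (σθ ^ 2)⁻¹ • (1 : Matrix (Fin n) (Fin n) ℝ) +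
      (σn ^ 2)⁻¹ • ∑ τ ∈ Finset.Icc 1 t, vecMulVec (h τ) (h τ)) :
    ∑ t ∈ Finset.Icc 1 T, h t ⬝ᵥ (J t)⁻¹ *ᵥ h t ≤
      n * σn ^ 2 * Real.log ((1 + γ) ^ 2 * σθ ^ 2 * T / σn ^ 2 + 1) := by
  have hpd (t : ℕ) : (J t).PosDef := by
    rw [hJ]
    refine (PosDef.one.smul (by positivity)).add_posSemidef
      (PosSemidef.smul (posSemidef_sum _ fun τ _ ↦ ?_) (by positivity))
    simpa using posSemidef_vecMulVec_self_star (h τ)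
  have hsucc (t : ℕ) : J (t + 1) = J t + (σn ^ 2)⁻¹ • vecMulVec (h (t + 1)) (h (t + 1)) := by
    rw [hJ, hJ, sum_Icc_succ_top (by omega), smul_add, add_assoc]
  have htelescope : (σn ^ 2)⁻¹ * ∑ t ∈ Icc 1 T, h t ⬝ᵥ (J t)⁻¹ *ᵥ h t ≤
      Real.log (J T).det - Real.log (J 0).det := by
    clear hnorm hT
    induction T with
    | zero => simp
    | succ t ih =>
      rw [sum_Icc_succ_top (by omega), mul_add]
      linarith [(hpd t).mul_dotProduct_inv_mulVec_le_log_det_sub (hpd (t + 1)) (hsucc t)]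
  set m : ℝ := (σθ ^ 2)⁻¹ + (σn ^ 2)⁻¹ * (T * (1 + γ) ^ 2) with hm
  have hm_pos : 0 < m := by positivity
  have hsq : ∑ t ∈ Icc 1 T, h t ⬝ᵥ h t ≤ T * (1 + γ) ^ 2 := by
    simpa using sum_le_card_nsmul (Icc 1 T) (fun t ↦ h t ⬝ᵥ h t) ((1 + γ) ^ 2) fun t ht ↦
      (Real.sqrt_le_left (by positivity)).1 (hnorm t ht)
  have htrace : (J T).trace ≤ Fintype.card (Fin n) * m := by
    have hn' : (1 : ℝ) ≤ n := by exact_mod_cast hn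
    rw [hJ]
    simp only [trace_add, trace_smul, trace_one, trace_sum, trace_vecMulVec, smul_eq_mul,
      Fintype.card_fin]
    calc (σθ ^ 2)⁻¹ * n + (σn ^ 2)⁻¹ * ∑ t ∈ Icc 1 T, h t ⬝ᵥ h t
        ≤ (σθ ^ 2)⁻¹ * n + n * ((σn ^ 2)⁻¹ * (T * (1 + γ) ^ 2)) := by
          refine add_le_add le_rfl ((mul_le_mul_of_nonneg_left hsq (by positivity)).trans ?_)
          exact le_mul_of_one_le_left (by positivity) hn'
      _ = n * m := by rw [hm]; ring
  have hlog := (hpd T).log_det_le_of_trace_le hm_pos htrace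
  have hlog₀ : Real.log (J 0).det = n * Real.log (σθ ^ 2)⁻¹ := by
    simp [hJ]
  have hratio : (1 + γ) ^ 2 * σθ ^ 2 * T / σn ^ 2 + 1 = m / (σθ ^ 2)⁻¹ := by
    rw [hm]
    field_simp
    ring
  rw [hratio, Real.log_div hm_pos.ne' (by positivity)]
  rw [Fintype.card_fin] at hlog
  have hbound := htelescope.trans (sub_le_sub hlog hlog₀.ge)
  rw [inv_mul_le_iff₀ (by positivity)] at hbound
  linarith
end

section
/- (Lemma 1, regret of OS-GPTD against the best fixed RF parameter.) Suppose γ ≥ 0, σ_n² ≤ 1/2, and for t = 1, …, T one has ‖h_t‖ ≤ 1 + γ and |r_t − h_tᵀ θ̂_{t-1}| ≤ B_e. Then for every θ* ∈ ℝⁿ, Σ_{t=1}^T l_t(θ̂_{t-1}) − Σ_{t=1}^T l_t(θ*) ≤ n B_e² log((1+γ)² σ_θ² T/σ_n² + 1) + ‖θ*‖²/(2σ_θ²), where l_t(θ) = (r_t − h_tᵀ θ)². -/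
open Matrix Finset

/-- **Sherman–Morrison**: a rank-one update of a matrix and the matching update of its inverse. -/
lemma add_smul_vecMulVec_mul_eq_one {m : Type*} [Fintype m] [DecidableEq m]
    {P S : Matrix m m ℝ} (hPS : P * S = 1) (v : m → ℝ) {s : ℝ} (hs : s ≠ 0)
    (hD : v ⬝ᵥ S *ᵥ v + s ≠ 0) :
    (P + s⁻¹ • vecMulVec v v) *
      (S - (v ⬝ᵥ S *ᵥ v + s)⁻¹ • vecMulVec (S *ᵥ v) (v ᵥ* S)) = 1 := by
  have hPSv : P *ᵥ (S *ᵥ v) = v := by rw [mulVec_mulVec, hPS, one_mulVec]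
  generalize hq : v ⬝ᵥ S *ᵥ v = q at hD ⊢
  simp only [add_mul, mul_sub, smul_mul_assoc, mul_smul_comm, mul_vecMulVec, vecMulVec_mul,
    vecMulVec_mulVec, hPS, hPSv, hq]
  ext i j
  simp only [Matrix.add_apply, Matrix.sub_apply, Matrix.smul_apply, vecMulVec_apply,
    smul_eq_mul, Pi.smul_apply, MulOpposite.smul_eq_mul_unop, MulOpposite.unop_op]
  field_simp
  ring

/-- The matrix determinant lemma for a symmetric rank-one update, in terms of a right inverse. -/
lemma det_add_smul_vecMulVec {m : Type*} [Fintype m] [DecidableEq m]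
    {P S : Matrix m m ℝ} (hPS : P * S = 1) (v : m → ℝ) (c : ℝ) :
    (P + c • vecMulVec v v).det = P.det * (1 + c * (v ⬝ᵥ S *ᵥ v)) := by
  have hfac : P + c • vecMulVec v v = P * (1 + c • vecMulVec (S *ᵥ v) v) := by
    rw [mul_add, mul_one, mul_smul_comm, mul_vecMulVec, mulVec_mulVec, hPS, one_mulVec]
  rw [hfac, det_mul, ← smul_vecMulVec, vecMulVec_eq Unit, det_one_add_replicateCol_mul_replicateRow,
    dotProduct_smul, smul_eq_mul]

/-- A trace bound on the log-determinant of a positive definite matrix (AM–GM for the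
eigenvalues). -/
lemma log_det_le_of_trace_le {m : Type*} [Fintype m] [DecidableEq m]
    {A : Matrix m m ℝ} (hA : A.PosDef) {M : ℝ} (hM : 0 < M)
    (htr : A.trace ≤ Fintype.card m * M) :
    Real.log A.det ≤ Fintype.card m * Real.log M := by
  have hdet : A.det = ∏ i, hA.1.eigenvalues i := hA.1.det_eq_prod_eigenvalues
  have htrace : A.trace = ∑ i, hA.1.eigenvalues i := hA.1.trace_eq_sum_eigenvalues
  rw [hdet, Real.log_prod fun i _ => (hA.eigenvalues_pos i).ne']
  calc ∑ i, Real.log (hA.1.eigenvalues i)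
      ≤ ∑ i, (Real.log M + (hA.1.eigenvalues i / M - 1)) := by
        refine Finset.sum_le_sum fun i _ => ?_
        have hi := hA.eigenvalues_pos i
        have := Real.log_le_sub_one_of_pos (div_pos hi hM)
        rw [Real.log_div hi.ne' hM.ne'] at this
        linarith
    _ = Fintype.card m * Real.log M + (A.trace / M - Fintype.card m) := by
        simp [Finset.sum_add_distrib, ← Finset.sum_div, htrace]
    _ ≤ Fintype.card m * Real.log M := by
        have := (div_le_iff₀ hM).2 htr
        linarith

/-- One step of recursive least squares: the exact change of the squared distance to a comparator,
measured in the current precision matrix. Here `u` is the current error and `e` the innovation. -/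
lemma recursive_least_squares_potential_step {m : Type*} [Fintype m] [DecidableEq m]
    {P S : Matrix m m ℝ} (hP : P.PosDef) (hPS : P * S = 1) (v u : m → ℝ) (e : ℝ)
    {s : ℝ} (hs : s ≠ 0) (hD : v ⬝ᵥ S *ᵥ v + s ≠ 0) :
    let u' := u + (e / (v ⬝ᵥ S *ᵥ v + s)) • (S *ᵥ v)
    u' ⬝ᵥ (P + s⁻¹ • vecMulVec v v) *ᵥ u' =
      u ⬝ᵥ P *ᵥ u + ((e + v ⬝ᵥ u) ^ 2 / s - e ^ 2 / (v ⬝ᵥ S *ᵥ v + s)) := by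
  intro u'
  have hPSv : P *ᵥ (S *ᵥ v) = v := by rw [mulVec_mulVec, hPS, one_mulVec]
  have hsymm : Pᵀ = P := hP.1
  have hcross : (S *ᵥ v) ⬝ᵥ P *ᵥ u = v ⬝ᵥ u := by
    rw [dotProduct_mulVec, ← mulVec_transpose, hsymm, hPSv]
  have hu : u ⬝ᵥ v = v ⬝ᵥ u := dotProduct_comm _ _
  have hq : (S *ᵥ v) ⬝ᵥ v = v ⬝ᵥ S *ᵥ v := dotProduct_comm _ _
  simp only [u', add_mulVec, smul_mulVec, vecMulVec_mulVec, mulVec_add, mulVec_smul, hPSv,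
    dotProduct_add, add_dotProduct, smul_dotProduct, dotProduct_smul, hcross, hu, hq,
    smul_eq_mul, op_smul_eq_smul]
  generalize v ⬝ᵥ S *ᵥ v = q at hD ⊢
  field_simp
  ring

/-- The precision (inverse covariance) matrix after `t` steps, with prior precision `a` and
observation precision `b`. -/
noncomputable def precisionMatrix {n : ℕ} (a b : ℝ) (h : ℕ → Fin n → ℝ) (t : ℕ) :
    Matrix (Fin n) (Fin n) ℝ :=
  a • 1 + ∑ i ∈ Finset.Icc 1 t, b • vecMulVec (h i) (h i)

lemma precisionMatrix_zero {n : ℕ} (a b : ℝ) (h : ℕ → Fin n → ℝ) :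
    precisionMatrix a b h 0 = a • 1 := by
  simp [precisionMatrix]

lemma precisionMatrix_succ {n : ℕ} (a b : ℝ) (h : ℕ → Fin n → ℝ) (t : ℕ) :
    precisionMatrix a b h (t + 1) =
      precisionMatrix a b h t + b • vecMulVec (h (t + 1)) (h (t + 1)) := by
  rw [precisionMatrix, Finset.sum_Icc_succ_top (by lia), ← add_assoc, precisionMatrix]

lemma precisionMatrix_posDef {n : ℕ} {a b : ℝ} (ha : 0 < a) (hb : 0 ≤ b) (h : ℕ → Fin n → ℝ)
    (t : ℕ) : (precisionMatrix a b h t).PosDef :=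
  (Matrix.PosDef.one.smul ha).add_posSemidef <| posSemidef_sum _ fun i _ =>
    (posSemidef_vecMulVec_self_star (h i)).smul hb

lemma precisionMatrix_trace_le {n : ℕ} {a b c : ℝ} (hb : 0 ≤ b) (h : ℕ → Fin n → ℝ) (t : ℕ)
    (hc : ∀ i ∈ Finset.Icc 1 t, h i ⬝ᵥ h i ≤ c) :
    (precisionMatrix a b h t).trace ≤ n * a + t * (b * c) := by
  have hsum : ∑ i ∈ Finset.Icc 1 t, b * (h i ⬝ᵥ h i) ≤ ∑ i ∈ Finset.Icc 1 t, b * c :=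
    Finset.sum_le_sum fun i hi => mul_le_mul_of_nonneg_left (hc i hi) hb
  have htrace : (precisionMatrix a b h t).trace =
      n * a + ∑ i ∈ Finset.Icc 1 t, b * (h i ⬝ᵥ h i) := by
    simp [precisionMatrix, trace_sum, mul_comm]
  rw [htrace]
  simpa using hsum

/-- **Lemma 1.** Regret of OS-GPTD against the best fixed RF parameter:
`∑_{t=1}^T l_t(θ̂_{t-1}) − ∑_{t=1}^T l_t(θ*)
   ≤ n B_e² log((1+γ)² σ_θ² T/σ_n² + 1) + ‖θ*‖²/(2σ_θ²)`. -/
theorem osgptd_lemma1_regret_bound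
    (n : ℕ) (hn : 1 ≤ n) (T : ℕ) (hT : 1 ≤ T)
    (σθ σn γ Be : ℝ) (hσθ : 0 < σθ) (hσn : 0 < σn) (hγ : 0 ≤ γ) (hBe : 0 < Be)
    (hσn2 : σn ^ 2 ≤ 1 / 2)
    (h : ℕ → Fin n → ℝ) (r : ℕ → ℝ)
    (θ : ℕ → Fin n → ℝ) (S : ℕ → Matrix (Fin n) (Fin n) ℝ)
    (hθ0 : θ 0 = 0)
    (hS0 : S 0 = σθ ^ 2 • (1 : Matrix (Fin n) (Fin n) ℝ))
    (hθrec : ∀ t : ℕ, θ (t + 1) = θ t +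
      ((r (t + 1) - h (t + 1) ⬝ᵥ θ t) / (h (t + 1) ⬝ᵥ S t *ᵥ h (t + 1) + σn ^ 2)) •
        (S t *ᵥ h (t + 1)))
    (hSrec : ∀ t : ℕ, S (t + 1) = S t -
      (h (t + 1) ⬝ᵥ S t *ᵥ h (t + 1) + σn ^ 2)⁻¹ •
        vecMulVec (S t *ᵥ h (t + 1)) (h (t + 1) ᵥ* S t))
    (hnorm : ∀ t ∈ Finset.Icc 1 T, Real.sqrt (h t ⬝ᵥ h t) ≤ 1 + γ)
    (hres : ∀ t ∈ Finset.Icc 1 T, |r t - h t ⬝ᵥ θ (t - 1)| ≤ Be) :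
    ∀ θs : Fin n → ℝ,
      ∑ t ∈ Finset.Icc 1 T, (r t - h t ⬝ᵥ θ (t - 1)) ^ 2
        - ∑ t ∈ Finset.Icc 1 T, (r t - h t ⬝ᵥ θs) ^ 2 ≤
      n * Be ^ 2 * Real.log ((1 + γ) ^ 2 * σθ ^ 2 * T / σn ^ 2 + 1)
        + (θs ⬝ᵥ θs) / (2 * σθ ^ 2) := by
  intro θs
  have hs : 0 < σn ^ 2 := by positivity
  have hp : 0 < σθ ^ 2 := by positivity
  set s := σn ^ 2
  set p := σθ ^ 2
  let P := precisionMatrix p⁻¹ s⁻¹ h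
  have hP : ∀ t, (P t).PosDef :=
    precisionMatrix_posDef (inv_pos.2 hp) (inv_pos.2 hs).le h
  have hPsucc : ∀ t, P (t + 1) = P t + s⁻¹ • vecMulVec (h (t + 1)) (h (t + 1)) :=
    precisionMatrix_succ _ _ h
  have hP0 : P 0 = p⁻¹ • 1 := precisionMatrix_zero _ _ h
  have hq_of : ∀ t, P t * S t = 1 → 0 ≤ h (t + 1) ⬝ᵥ S t *ᵥ h (t + 1) := by
    intro t ht
    rw [← inv_eq_right_inv ht]
    exact (hP t).inv.posSemidef.dotProduct_mulVec_nonneg (h (t + 1))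
  have hPS : ∀ t, P t * S t = 1 := by
    intro t
    induction t with
    | zero => simp [hP0, hS0, smul_smul, hp.ne']
    | succ t ih =>
      rw [hPsucc, hSrec]
      exact add_smul_vecMulVec_mul_eq_one ih _ hs.ne' (by linarith [hq_of t ih])
  have hq : ∀ t, 0 ≤ h (t + 1) ⬝ᵥ S t *ᵥ h (t + 1) := fun t => hq_of t (hPS t)
  let V : ℕ → ℝ := fun t => (θ t - θs) ⬝ᵥ P t *ᵥ (θ t - θs)
  have hstep : ∀ t, |r (t + 1) - h (t + 1) ⬝ᵥ θ t| ≤ Be →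
      (r (t + 1) - h (t + 1) ⬝ᵥ θ t) ^ 2 - (r (t + 1) - h (t + 1) ⬝ᵥ θs) ^ 2 ≤
        (Be ^ 2 * Real.log (P (t + 1)).det - s * V (t + 1)) -
          (Be ^ 2 * Real.log (P t).det - s * V t) := by
    intro t ht
    have hqt := hq t
    have hVt := recursive_least_squares_potential_step (hP t) (hPS t) (h (t + 1)) (θ t - θs)
      (r (t + 1) - h (t + 1) ⬝ᵥ θ t) hs.ne' (by linarith)
    have hdet := det_add_smul_vecMulVec (hPS t) (h (t + 1)) s⁻¹
    have hu' : θ (t + 1) - θs = θ t - θs +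
        ((r (t + 1) - h (t + 1) ⬝ᵥ θ t) / (h (t + 1) ⬝ᵥ S t *ᵥ h (t + 1) + s)) •
          (S t *ᵥ h (t + 1)) := by
      rw [hθrec]; abel
    simp only [← hu', ← hPsucc] at hVt hdet
    have hVs : V (t + 1) = V t + _ := hVt
    rw [dotProduct_sub, show ∀ a b c : ℝ, a - b + (b - c) = a - c by intros; ring] at hVs
    generalize h (t + 1) ⬝ᵥ S t *ᵥ h (t + 1) = q at hVs hdet hqt
    generalize r (t + 1) - h (t + 1) ⬝ᵥ θ t = e at hVs ht ⊢
    generalize r (t + 1) - h (t + 1) ⬝ᵥ θs = f at hVs ⊢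
    have hx : 0 < 1 + s⁻¹ * q := by positivity
    have hlog : q / (q + s) ≤ Real.log (1 + s⁻¹ * q) := by
      have h1 := Real.one_sub_inv_le_log_of_pos hx
      have h2 : 1 - (1 + s⁻¹ * q)⁻¹ = q / (q + s) := by
        have : q + s ≠ 0 := by positivity
        have : s + q ≠ 0 := by positivity
        field_simp
        ring
      rwa [h2] at h1
    have he : e ^ 2 * (q / (q + s)) ≤ Be ^ 2 * Real.log (1 + s⁻¹ * q) :=
      mul_le_mul (sq_le_sq' (abs_le.1 ht).1 (abs_le.1 ht).2) hlog (by positivity) (by positivity)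
    have hsplit : s * (f ^ 2 / s - e ^ 2 / (q + s)) = f ^ 2 - e ^ 2 + e ^ 2 * (q / (q + s)) := by
      have : q + s ≠ 0 := by positivity
      field_simp
      ring
    rw [hdet, Real.log_mul (hP t).det_pos.ne' hx.ne', hVs, mul_add s, hsplit]
    linarith
  have hregret : ∀ k ≤ T,
      ∑ t ∈ Finset.Icc 1 k, (r t - h t ⬝ᵥ θ (t - 1)) ^ 2
        - ∑ t ∈ Finset.Icc 1 k, (r t - h t ⬝ᵥ θs) ^ 2 ≤
      (Be ^ 2 * Real.log (P k).det - s * V k) - (Be ^ 2 * Real.log (P 0).det - s * V 0) := by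
    intro k hk
    induction k with
    | zero => simp
    | succ k ih =>
      have hk' := hres (k + 1) (Finset.mem_Icc.2 ⟨by lia, hk⟩)
      rw [Nat.add_sub_cancel] at hk'
      rw [Finset.sum_Icc_succ_top (by lia), Finset.sum_Icc_succ_top (by lia), Nat.add_sub_cancel]
      linarith [hstep k hk', ih (by lia)]
  have hVT : 0 ≤ V T := (hP T).posSemidef.dotProduct_mulVec_nonneg (θ T - θs)
  have hV0 : V 0 = p⁻¹ * (θs ⬝ᵥ θs) := by
    simp [V, hP0, hθ0, smul_mulVec, mulVec_neg]
  have hprior : s * V 0 ≤ (θs ⬝ᵥ θs) / (2 * p) := by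
    have hnn : 0 ≤ p⁻¹ * (θs ⬝ᵥ θs) :=
      mul_nonneg (inv_pos.2 hp).le (dotProduct_self_star_nonneg θs)
    calc s * V 0 ≤ 1 / 2 * (p⁻¹ * (θs ⬝ᵥ θs)) := by
          rw [hV0]; exact mul_le_mul_of_nonneg_right hσn2 hnn
      _ = (θs ⬝ᵥ θs) / (2 * p) := by field_simp
  have hnorm' : ∀ t ∈ Finset.Icc 1 T, h t ⬝ᵥ h t ≤ (1 + γ) ^ 2 := fun t ht =>
    (Real.sqrt_le_left (by linarith)).1 (hnorm t ht)
  have hn' : (1 : ℝ) ≤ n := by exact_mod_cast hn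
  have harg : 0 < (1 + γ) ^ 2 * p * T / s + 1 := by positivity
  have hlogT : Real.log (P T).det ≤
      n * Real.log (p⁻¹ * ((1 + γ) ^ 2 * p * T / s + 1)) := by
    have htr := precisionMatrix_trace_le (a := p⁻¹) (inv_pos.2 hs).le h T hnorm'
    have hle : (n : ℝ) * p⁻¹ + T * (s⁻¹ * (1 + γ) ^ 2) ≤
        n * (p⁻¹ * ((1 + γ) ^ 2 * p * T / s + 1)) := by
      have hc : 0 ≤ T * (s⁻¹ * (1 + γ) ^ 2) := by positivity
      have heq : (n : ℝ) * (p⁻¹ * ((1 + γ) ^ 2 * p * T / s + 1)) =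
          n * p⁻¹ + n * (T * (s⁻¹ * (1 + γ) ^ 2)) := by
        field_simp
        ring
      rw [heq]
      linarith [le_mul_of_one_le_left hc hn']
    simpa using log_det_le_of_trace_le (hP T) (by positivity)
      (M := p⁻¹ * ((1 + γ) ^ 2 * p * T / s + 1)) (by simpa using htr.trans hle)
  have hlog0 : Real.log (P 0).det = n * Real.log p⁻¹ := by
    rw [hP0, det_smul, det_one, mul_one, Fintype.card_fin, Real.log_pow]
  rw [Real.log_mul (inv_pos.2 hp).ne' harg.ne'] at hlogT
  have hfinal : Be ^ 2 * (Real.log (P T).det - Real.log (P 0).det) ≤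
      Be ^ 2 * (n * Real.log ((1 + γ) ^ 2 * p * T / s + 1)) :=
    mul_le_mul_of_nonneg_left (by rw [hlog0]; linarith) (by positivity)
  linarith [hregret T le_rfl, mul_nonneg hs.le hVT]
end

section
/- Suppose the Bellman residuals of both the RKHS comparator v* and its RF approximant v̌* are bounded: |r_t − v*(s_t) + γ v*(s_{t+1})| ≤ B_e and |r_t − v̌*(s_t) + γ v̌*(s_{t+1})| ≤ B_e for t = 1, …, T. Then under the uniform ε-approximation of the kernel by random features, for each t one has |l_t(v̌*) − l_t(v*)| ≤ 2(1+γ) ε B_e C, and consequently Σ_{t=1}^T l_t(v̌*) − Σ_{t=1}^T l_t(v*) ≤ 2(1+γ) ε B_e C T. -/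
open Matrix Finset

/-- The random-feature map `φ_ζ : ℝ^d → ℝ^{2D}`, with `ℝ^{2D}` realized as
`Fin D × Bool → ℝ`. -/
noncomputable def rfMap (d D : ℕ) (ζ : Fin D → Fin d → ℝ) (s : Fin d → ℝ) :
    Fin D × Bool → ℝ :=
  fun p => (1 / Real.sqrt D) *
    (if p.2 then Real.sin (ζ p.1 ⬝ᵥ s) else Real.cos (ζ p.1 ⬝ᵥ s))

theorem abs_sum_mul_sub_sum_mul_le {ι : Type*} (S : Finset ι) (a f g : ι → ℝ) {ε : ℝ}
    (h : ∀ i ∈ S, |f i - g i| ≤ ε) :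
    |∑ i ∈ S, a i * f i - ∑ i ∈ S, a i * g i| ≤ ε * ∑ i ∈ S, |a i| := by
  rw [← Finset.sum_sub_distrib, Finset.mul_sum]
  refine (Finset.abs_sum_le_sum_abs _ _).trans (Finset.sum_le_sum fun i hi => ?_)
  rw [← mul_sub, abs_mul, mul_comm]
  exact mul_le_mul_of_nonneg_right (h i hi) (abs_nonneg _)

theorem abs_sq_sub_sq_le {a b B δ : ℝ} (ha : |a| ≤ B) (hb : |b| ≤ B) (hab : |a - b| ≤ δ) :
    |a ^ 2 - b ^ 2| ≤ 2 * B * δ := by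
  rw [sq_sub_sq, abs_mul]
  have hsum : |a + b| ≤ 2 * B := (abs_add_le a b).trans (by linarith)
  exact mul_le_mul hsum hab (abs_nonneg _) ((abs_nonneg _).trans hsum)

theorem abs_bellman_residual_sub_le {γ δ : ℝ} (hγ : 0 ≤ γ) (r : ℝ) {v w v' w' : ℝ}
    (h : |v - w| ≤ δ) (h' : |v' - w'| ≤ δ) :
    |(r - v + γ * v') - (r - w + γ * w')| ≤ (1 + γ) * δ := by
  calc |(r - v + γ * v') - (r - w + γ * w')| = |γ * (v' - w') - (v - w)| := by ring_nf
    _ ≤ |γ * (v' - w')| + |v - w| := abs_sub _ _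
    _ = γ * |v' - w'| + |v - w| := by rw [abs_mul, abs_of_nonneg hγ]
    _ ≤ γ * δ + δ := add_le_add (mul_le_mul_of_nonneg_left h' hγ) h
    _ = (1 + γ) * δ := by ring

/-- If the Bellman residuals of the RKHS comparator `v*` and of its
RF approximant `v̌*` are bounded by `B_e`, then under the uniform ε-approximation of
the kernel by random features, `|l_t(v̌*) − l_t(v*)| ≤ 2(1+γ) ε B_e C` for each
`t = 1, …, T`, and consequently
`∑_{t=1}^T l_t(v̌*) − ∑_{t=1}^T l_t(v*) ≤ 2(1+γ) ε B_e C T`,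
where `l_t(v) = (r_t − v(s_t) + γ v(s_{t+1}))²`. -/
theorem rf_comparator_bellman_loss_bound
    (d D T : ℕ) (hd : 1 ≤ d) (hD : 1 ≤ D) (hT : 1 ≤ T)
    (ζ : Fin D → Fin d → ℝ)
    (s : ℕ → Fin d → ℝ) (α : ℕ → ℝ) (r : ℕ → ℝ)
    (σθ ε γ Be : ℝ) (hσθ : 0 < σθ) (hε : 0 < ε) (hγ0 : 0 ≤ γ) (hγ1 : γ < 1)
    (hBe : 0 < Be)
    (κ : (Fin d → ℝ) → (Fin d → ℝ) → ℝ)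
    (happrox : ∀ x y : Fin d → ℝ, |rfMap d D ζ x ⬝ᵥ rfMap d D ζ y - κ x y| < ε)
    (vstar : (Fin d → ℝ) → ℝ)
    (hvstar : ∀ x, vstar x = σθ ^ 2 * ∑ t ∈ Finset.Icc 1 T, α t * κ x (s t))
    (θs : Fin D × Bool → ℝ)
    (hθs : θs = σθ ^ 2 • ∑ t ∈ Finset.Icc 1 T, α t • rfMap d D ζ (s t))
    (vcheck : (Fin d → ℝ) → ℝ)
    (hvcheck : ∀ x, vcheck x = rfMap d D ζ x ⬝ᵥ θs)
    (C : ℝ) (hC : C = σθ ^ 2 * ∑ t ∈ Finset.Icc 1 T, |α t|)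
    (hresV : ∀ t ∈ Finset.Icc 1 T, |r t - vstar (s t) + γ * vstar (s (t + 1))| ≤ Be)
    (hresVc : ∀ t ∈ Finset.Icc 1 T, |r t - vcheck (s t) + γ * vcheck (s (t + 1))| ≤ Be) :
    (∀ t ∈ Finset.Icc 1 T,
      |(r t - vcheck (s t) + γ * vcheck (s (t + 1))) ^ 2
        - (r t - vstar (s t) + γ * vstar (s (t + 1))) ^ 2| ≤ 2 * (1 + γ) * ε * Be * C) ∧
    (∑ t ∈ Finset.Icc 1 T, (r t - vcheck (s t) + γ * vcheck (s (t + 1))) ^ 2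
      - ∑ t ∈ Finset.Icc 1 T, (r t - vstar (s t) + γ * vstar (s (t + 1))) ^ 2
      ≤ 2 * (1 + γ) * ε * Be * C * T) := by
  have hv : ∀ x, |vcheck x - vstar x| ≤ ε * C := by
    intro x
    have hdot : vcheck x =
        σθ ^ 2 * ∑ t ∈ Finset.Icc 1 T, α t * (rfMap d D ζ x ⬝ᵥ rfMap d D ζ (s t)) := by
      simp only [hvcheck, hθs, dotProduct_smul, dotProduct_sum, smul_eq_mul]
    rw [hdot, hvstar, hC, ← mul_sub, abs_mul, abs_of_nonneg (sq_nonneg σθ), mul_left_comm]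
    exact mul_le_mul_of_nonneg_left
      (abs_sum_mul_sub_sum_mul_le _ _ _ _ fun t _ => (happrox x (s t)).le) (sq_nonneg σθ)
  have hloss : ∀ t ∈ Finset.Icc 1 T,
      |(r t - vcheck (s t) + γ * vcheck (s (t + 1))) ^ 2
        - (r t - vstar (s t) + γ * vstar (s (t + 1))) ^ 2| ≤ 2 * (1 + γ) * ε * Be * C := by
    intro t ht
    refine (abs_sq_sub_sq_le (hresVc t ht) (hresV t ht)
      (abs_bellman_residual_sub_le hγ0 (r t) (hv _) (hv _))).trans_eq ?_
    ring
  refine ⟨hloss, ?_⟩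
  rw [← Finset.sum_sub_distrib]
  refine (Finset.sum_le_card_nsmul _ _ _ fun t ht => (le_abs_self _).trans (hloss t ht)).trans_eq ?_
  rw [Nat.card_Icc, nsmul_eq_mul, Nat.add_sub_cancel, mul_comm]
end

section
/- (Per-step online stability of OS-GPTD.) Let t ≥ 1 and suppose |r_t − h_tᵀ θ̂_{t-1}| ≤ B_e. Then for every φ ∈ ℝⁿ with ‖φ‖ ≤ 1, the successive value predictions change slowly: (φᵀ(θ̂_t − θ̂_{t-1}))² ≤ (B_e²/σ_n²) · Tr(Σ_{t-1} − Σ_t). -/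
open Matrix Finset

/-- Per-step online stability of OS-GPTD: if
`|r_t − h_tᵀθ̂_{t-1}| ≤ B_e`, then for every `φ` with `‖φ‖ ≤ 1`,
`(φᵀ(θ̂_t − θ̂_{t-1}))² ≤ (B_e²/σ_n²) Tr(Σ_{t-1} − Σ_t)`. -/
theorem osgptd_per_step_stability
    (n : ℕ) (hn : 1 ≤ n) (σθ σn Be : ℝ) (hσθ : 0 < σθ) (hσn : 0 < σn) (hBe : 0 < Be)
    (h : ℕ → Fin n → ℝ) (r : ℕ → ℝ)
    (θ : ℕ → Fin n → ℝ) (S : ℕ → Matrix (Fin n) (Fin n) ℝ)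
    (hθ0 : θ 0 = 0)
    (hS0 : S 0 = σθ ^ 2 • (1 : Matrix (Fin n) (Fin n) ℝ))
    (hθrec : ∀ t : ℕ, θ (t + 1) = θ t +
      ((r (t + 1) - h (t + 1) ⬝ᵥ θ t) / (h (t + 1) ⬝ᵥ S t *ᵥ h (t + 1) + σn ^ 2)) •
        (S t *ᵥ h (t + 1)))
    (hSrec : ∀ t : ℕ, S (t + 1) = S t -
      (h (t + 1) ⬝ᵥ S t *ᵥ h (t + 1) + σn ^ 2)⁻¹ •
        vecMulVec (S t *ᵥ h (t + 1)) (h (t + 1) ᵥ* S t))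
    (hSpd : ∀ t : ℕ, (S t).PosDef) :
    ∀ t : ℕ, |r (t + 1) - h (t + 1) ⬝ᵥ θ t| ≤ Be →
      ∀ φ : Fin n → ℝ, Real.sqrt (φ ⬝ᵥ φ) ≤ 1 →
        (φ ⬝ᵥ (θ (t + 1) - θ t)) ^ 2 ≤ Be ^ 2 / σn ^ 2 * (S t - S (t + 1)).trace := by
  intro t hr φ hφ
  have hsymm : h (t + 1) ᵥ* S t = S t *ᵥ h (t + 1) := by
    have hT : (S t)ᵀ = S t := by simpa using (hSpd t).isHermitian.eq
    rw [← mulVec_transpose, hT]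
  have hquad : 0 ≤ h (t + 1) ⬝ᵥ S t *ᵥ h (t + 1) := by
    simpa using (hSpd t).posSemidef.dotProduct_mulVec_nonneg (h (t + 1))
  rw [hθrec t, hSrec t, hsymm]
  set g := S t *ᵥ h (t + 1)
  set δ := r (t + 1) - h (t + 1) ⬝ᵥ θ t
  set d := h (t + 1) ⬝ᵥ g + σn ^ 2 with hd
  have hσ : 0 < σn ^ 2 := by positivity
  have hσd : σn ^ 2 ≤ d := by linarith
  have hdpos : 0 < d := by linarith
  rw [add_sub_cancel_left, sub_sub_cancel, trace_smul, trace_vecMulVec, dotProduct_smul,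
    smul_eq_mul, smul_eq_mul]
  have hg : 0 ≤ g ⬝ᵥ g := by simpa using dotProduct_star_self_nonneg g
  have hφ1 : φ ⬝ᵥ φ ≤ 1 := by simpa using Real.sqrt_le_iff.mp hφ
  have hcs : (φ ⬝ᵥ g) ^ 2 ≤ g ⬝ᵥ g := by
    have hcauchy : (φ ⬝ᵥ g) ^ 2 ≤ (φ ⬝ᵥ φ) * (g ⬝ᵥ g) := by
      simpa only [dotProduct, sq] using sum_mul_sq_le_sq_mul_sq univ φ g
    exact hcauchy.trans (mul_le_of_le_one_left hg hφ1)
  have hδ : δ ^ 2 ≤ Be ^ 2 := sq_le_sq.mpr (hr.trans (le_abs_self Be))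
  calc (δ / d * φ ⬝ᵥ g) ^ 2 = δ ^ 2 / d * (d⁻¹ * (φ ⬝ᵥ g) ^ 2) := by
        field_simp
    _ ≤ Be ^ 2 / σn ^ 2 * (d⁻¹ * g ⬝ᵥ g) := by gcongr
end

section
/- (Online stability of OS-GPTD.) Suppose |r_t − h_tᵀ θ̂_{t-1}| ≤ B_e for all t ≥ 1, and let (φ_t)_{t≥1} be any sequence in ℝⁿ with ‖φ_t‖ ≤ 1. Then for every T ≥ 1, Σ_{t=1}^T (φ_tᵀ(θ̂_t − θ̂_{t-1}))² ≤ (B_e²/σ_n²) · Tr(Σ_0 − Σ_T) ≤ n σ_θ² B_e²/σ_n², and consequently lim_{T→∞} (1/T) Σ_{t=1}^T (φ_tᵀ(θ̂_t − θ̂_{t-1}))² = 0. -/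
open Matrix Finset Filter

/-- Cauchy–Schwarz for the dot product with a vector of Euclidean norm at most one. -/
lemma dotProduct_sq_le_of_sqrt_le_one {ι : Type*} [Fintype ι] {x : ι → ℝ}
    (hx : Real.sqrt (x ⬝ᵥ x) ≤ 1) (v : ι → ℝ) : (x ⬝ᵥ v) ^ 2 ≤ v ⬝ᵥ v := by
  have hx1 : x ⬝ᵥ x ≤ 1 := by simpa using (Real.sqrt_le_iff.mp hx).2
  have hv : 0 ≤ v ⬝ᵥ v := Finset.sum_nonneg fun i _ => mul_self_nonneg (v i)
  have hcs : (x ⬝ᵥ v) ^ 2 ≤ (x ⬝ᵥ x) * (v ⬝ᵥ v) := by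
    simpa only [dotProduct, sq] using Finset.sum_mul_sq_le_sq_mul_sq Finset.univ x v
  nlinarith

/-- A scalar gain `e / d` applied to a quantity with square at most `w`. -/
lemma gain_sq_le {e d a w b c : ℝ} (he : |e| ≤ b) (hc : 0 < c) (hcd : c ≤ d)
    (ha : a ^ 2 ≤ w) : (e / d * a) ^ 2 ≤ b ^ 2 / c * (d⁻¹ * w) := by
  have hd : 0 < d := hc.trans_le hcd
  have he2 : e ^ 2 ≤ b ^ 2 := sq_le_sq' (abs_le.mp he).1 (abs_le.mp he).2
  have hw : 0 ≤ w := (sq_nonneg a).trans ha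
  calc (e / d * a) ^ 2 = e ^ 2 / d * (d⁻¹ * a ^ 2) := by field_simp
    _ ≤ b ^ 2 / c * (d⁻¹ * w) := by gcongr

/-- Online stability of OS-GPTD: if `|r_t − h_tᵀθ̂_{t-1}| ≤ B_e` for
all `t ≥ 1` and `‖φ_t‖ ≤ 1`, then for every `T ≥ 1`,
`∑_{t=1}^T (φ_tᵀ(θ̂_t − θ̂_{t-1}))² ≤ (B_e²/σ_n²) Tr(Σ_0 − Σ_T) ≤ n σ_θ² B_e²/σ_n²`,
and consequently `(1/T) ∑_{t=1}^T (φ_tᵀ(θ̂_t − θ̂_{t-1}))² → 0` as `T → ∞`. -/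
theorem osgptd_online_stability
    (n : ℕ) (hn : 1 ≤ n) (σθ σn Be : ℝ) (hσθ : 0 < σθ) (hσn : 0 < σn) (hBe : 0 < Be)
    (h : ℕ → Fin n → ℝ) (r : ℕ → ℝ)
    (θ : ℕ → Fin n → ℝ) (S : ℕ → Matrix (Fin n) (Fin n) ℝ)
    (hθ0 : θ 0 = 0)
    (hS0 : S 0 = σθ ^ 2 • (1 : Matrix (Fin n) (Fin n) ℝ))
    (hθrec : ∀ t : ℕ, θ (t + 1) = θ t +
      ((r (t + 1) - h (t + 1) ⬝ᵥ θ t) / (h (t + 1) ⬝ᵥ S t *ᵥ h (t + 1) + σn ^ 2)) •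
        (S t *ᵥ h (t + 1)))
    (hSrec : ∀ t : ℕ, S (t + 1) = S t -
      (h (t + 1) ⬝ᵥ S t *ᵥ h (t + 1) + σn ^ 2)⁻¹ •
        vecMulVec (S t *ᵥ h (t + 1)) (h (t + 1) ᵥ* S t))
    (hSpd : ∀ t : ℕ, (S t).PosDef)
    (hres : ∀ t : ℕ, 1 ≤ t → |r t - h t ⬝ᵥ θ (t - 1)| ≤ Be)
    (φ : ℕ → Fin n → ℝ) (hφ : ∀ t : ℕ, Real.sqrt (φ t ⬝ᵥ φ t) ≤ 1) :
    (∀ T : ℕ, 1 ≤ T →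
      ∑ t ∈ Finset.Icc 1 T, (φ t ⬝ᵥ (θ t - θ (t - 1))) ^ 2 ≤
          Be ^ 2 / σn ^ 2 * (S 0 - S T).trace ∧
        Be ^ 2 / σn ^ 2 * (S 0 - S T).trace ≤ n * σθ ^ 2 * Be ^ 2 / σn ^ 2) ∧
    Tendsto
      (fun T : ℕ => (1 / (T : ℝ)) * ∑ t ∈ Finset.Icc 1 T, (φ t ⬝ᵥ (θ t - θ (t - 1))) ^ 2)
      atTop (nhds 0) := by
  have step : ∀ t : ℕ, (φ (t + 1) ⬝ᵥ (θ (t + 1) - θ t)) ^ 2 ≤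
      Be ^ 2 / σn ^ 2 * (S t - S (t + 1)).trace := by
    intro t
    have hsymm : h (t + 1) ᵥ* S t = S t *ᵥ h (t + 1) := by
      have hT : (S t)ᵀ = S t := by simpa using (hSpd t).isHermitian.eq
      rw [← mulVec_transpose, hT]
    have hs : 0 ≤ h (t + 1) ⬝ᵥ S t *ᵥ h (t + 1) := by
      simpa using (hSpd t).posSemidef.dotProduct_mulVec_nonneg (h (t + 1))
    rw [hSrec t, hθrec t, hsymm, sub_sub_cancel, add_sub_cancel_left, trace_smul,
      trace_vecMulVec, dotProduct_smul, smul_eq_mul, smul_eq_mul]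
    exact gain_sq_le (by simpa using hres (t + 1) (by omega)) (by positivity)
      (by linarith) (dotProduct_sq_le_of_sqrt_le_one (hφ (t + 1)) _)
  have sum_le : ∀ T : ℕ, ∑ t ∈ Finset.Icc 1 T, (φ t ⬝ᵥ (θ t - θ (t - 1))) ^ 2 ≤
      Be ^ 2 / σn ^ 2 * (S 0 - S T).trace := by
    intro T
    induction T with
    | zero => simp
    | succ T ih =>
      rw [Finset.sum_Icc_succ_top (by omega), Nat.add_sub_cancel]
      calc _ ≤ _ := add_le_add ih (step T)
        _ = _ := by simp only [trace_sub]; ring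
  have trace_le : ∀ T : ℕ, Be ^ 2 / σn ^ 2 * (S 0 - S T).trace ≤
      n * σθ ^ 2 * Be ^ 2 / σn ^ 2 := by
    intro T
    have hT : (S 0 - S T).trace ≤ n * σθ ^ 2 := by
      have := (hSpd T).posSemidef.trace_nonneg
      rw [trace_sub, hS0, trace_smul, trace_one, Fintype.card_fin, smul_eq_mul]
      linarith
    calc _ ≤ Be ^ 2 / σn ^ 2 * (n * σθ ^ 2) := by gcongr
      _ = _ := by ring
  refine ⟨fun T _ => ⟨sum_le T, trace_le T⟩, ?_⟩
  refine squeeze_zero (fun T => by positivity)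
    (fun T => mul_le_mul_of_nonneg_left ((sum_le T).trans (trace_le T)) (by positivity)) ?_
  simpa using tendsto_one_div_atTop_nhds_zero_nat.mul_const (n * σθ ^ 2 * Be ^ 2 / σn ^ 2)
end

section
/- (Theorem 2, long-term reward prediction error bound.) Suppose |r_t − h_tᵀ θ̂_{t-1}| ≤ B_e for all t ≥ 1, and let (φ_t)_{t≥1} be a sequence in ℝⁿ with ‖φ_t‖ ≤ 1. Let (e_t)_{t≥1} and (e*_t)_{t≥1} be real sequences and C', c₁, c₂ ≥ 0 constants such that for all T ≥ 2: (1−γ)² Σ_{t=1}^T e_t² ≤ 2(1+γ)² Σ_{t=1}^T (e*_t)² + C' + 2γ² Σ_{t=1}^T (φ_tᵀ(θ̂_t − θ̂_{t-1}))² + 2(c₁ log T + c₂). Then the time-averaged squared online prediction error of the long-term rewards satisfies limsup_{T→∞} (1/T)[Σ_{t=1}^T e_t² − (2(1+γ)²/(1−γ)²) Σ_{t=1}^T (e*_t)²] ≤ 0. -/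
open Matrix Finset Filter

/-- One rank-one covariance downdate: the squared projection of the gain step on a vector of
norm at most one is controlled by the decrease of the trace of the covariance. -/
theorem sq_dotProduct_gain_le_trace_sub {n : ℕ} {S S' : Matrix (Fin n) (Fin n) ℝ}
    {x φ : Fin n → ℝ} {σ B ρ : ℝ} (hσ : 0 < σ) (hS : S.PosDef)
    (hS' : S' = S - (x ⬝ᵥ S *ᵥ x + σ ^ 2)⁻¹ • vecMulVec (S *ᵥ x) (x ᵥ* S))
    (hρ : |ρ| ≤ B) (hφ : φ ⬝ᵥ φ ≤ 1) :
    (φ ⬝ᵥ ((ρ / (x ⬝ᵥ S *ᵥ x + σ ^ 2)) • (S *ᵥ x))) ^ 2 ≤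
      B ^ 2 / σ ^ 2 * (S.trace - S'.trace) := by
  have hsymm : x ᵥ* S = S *ᵥ x := by
    have hT : Sᵀ = S := by
      have := hS.isHermitian.eq
      rwa [conjTranspose_eq_transpose_of_trivial] at this
    conv_lhs => rw [← hT]
    exact vecMul_transpose S x
  have hq : 0 ≤ x ⬝ᵥ S *ᵥ x := by
    simpa using hS.posSemidef.dotProduct_mulVec_nonneg x
  have htr : S.trace - S'.trace =
      (x ⬝ᵥ S *ᵥ x + σ ^ 2)⁻¹ * ((S *ᵥ x) ⬝ᵥ (S *ᵥ x)) := by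
    rw [hS', trace_sub, trace_smul, hsymm, trace_vecMulVec, smul_eq_mul]
    ring
  rw [htr, dotProduct_smul, smul_eq_mul]
  generalize S *ᵥ x = v at *
  generalize x ⬝ᵥ v = q at *
  have hσ2 : 0 < σ ^ 2 := by positivity
  have hcs : (φ ⬝ᵥ v) ^ 2 ≤ (φ ⬝ᵥ φ) * (v ⬝ᵥ v) := by
    simpa [dotProduct, sq] using Finset.sum_mul_sq_le_sq_mul_sq Finset.univ φ v
  have hvv : 0 ≤ v ⬝ᵥ v := by simpa using dotProduct_star_self_nonneg v
  have hφv : (φ ⬝ᵥ v) ^ 2 ≤ v ⬝ᵥ v :=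
    hcs.trans (mul_le_of_le_one_left hvv hφ)
  have hρ2 : ρ ^ 2 ≤ B ^ 2 := sq_le_sq' (abs_le.mp hρ).1 (abs_le.mp hρ).2
  calc (ρ / (q + σ ^ 2) * (φ ⬝ᵥ v)) ^ 2
      = ρ ^ 2 / (q + σ ^ 2) * ((q + σ ^ 2)⁻¹ * (φ ⬝ᵥ v) ^ 2) := by
        rw [mul_pow, div_pow]
        field_simp
    _ ≤ B ^ 2 / σ ^ 2 * ((q + σ ^ 2)⁻¹ * (v ⬝ᵥ v)) := by
        gcongr
        linarith

/-- A real sequence eventually dominated by a sequence tending to zero has nonpositive `limsup`. -/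
theorem limsup_nonpos_of_eventually_le_of_tendsto_zero {f g : ℕ → ℝ}
    (hfg : ∀ᶠ T in atTop, f T ≤ g T) (hg : Tendsto g atTop (nhds 0)) :
    limsup f atTop ≤ 0 := by
  rw [limsup_eq]
  by_cases hb : BddBelow {a | ∀ᶠ T in atTop, f T ≤ a}
  · refine le_of_forall_pos_le_add fun ε hε => ?_
    rw [zero_add]
    refine csInf_le hb ?_
    filter_upwards [hfg, hg.eventually_le_const hε] with T h₁ h₂
    exact h₁.trans h₂
  · exact (Real.sInf_of_not_bddBelow hb).le

/-- **Theorem 2.** Long-term reward prediction error bound: under the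
online-prediction-error inequality of Sun and Bagnell relating the prediction errors
`e_t`, the comparator errors `e*_t`, the OS-GPTD stability terms, and a logarithmically
bounded Bellman-error regret, the time-averaged squared online prediction error
satisfies
`limsup_{T→∞} (1/T)[∑_{t=1}^T e_t² − (2(1+γ)²/(1−γ)²) ∑_{t=1}^T (e*_t)²] ≤ 0`. -/
theorem osgptd_theorem2_long_term_prediction_error
    (n : ℕ) (hn : 1 ≤ n) (σθ σn Be γ : ℝ)
    (hσθ : 0 < σθ) (hσn : 0 < σn) (hBe : 0 < Be) (hγ0 : 0 ≤ γ) (hγ1 : γ < 1)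
    (h : ℕ → Fin n → ℝ) (r : ℕ → ℝ)
    (θ : ℕ → Fin n → ℝ) (S : ℕ → Matrix (Fin n) (Fin n) ℝ)
    (hθ0 : θ 0 = 0)
    (hS0 : S 0 = σθ ^ 2 • (1 : Matrix (Fin n) (Fin n) ℝ))
    (hθrec : ∀ t : ℕ, θ (t + 1) = θ t +
      ((r (t + 1) - h (t + 1) ⬝ᵥ θ t) / (h (t + 1) ⬝ᵥ S t *ᵥ h (t + 1) + σn ^ 2)) •
        (S t *ᵥ h (t + 1)))
    (hSrec : ∀ t : ℕ, S (t + 1) = S t -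
      (h (t + 1) ⬝ᵥ S t *ᵥ h (t + 1) + σn ^ 2)⁻¹ •
        vecMulVec (S t *ᵥ h (t + 1)) (h (t + 1) ᵥ* S t))
    (hSpd : ∀ t : ℕ, (S t).PosDef)
    (hres : ∀ t : ℕ, 1 ≤ t → |r t - h t ⬝ᵥ θ (t - 1)| ≤ Be)
    (φ : ℕ → Fin n → ℝ) (hφ : ∀ t : ℕ, Real.sqrt (φ t ⬝ᵥ φ t) ≤ 1)
    (e es : ℕ → ℝ) (C' c₁ c₂ : ℝ) (hC' : 0 ≤ C') (hc₁ : 0 ≤ c₁) (hc₂ : 0 ≤ c₂)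
    (hineq : ∀ T : ℕ, 2 ≤ T →
      (1 - γ) ^ 2 * ∑ t ∈ Finset.Icc 1 T, e t ^ 2 ≤
        2 * (1 + γ) ^ 2 * ∑ t ∈ Finset.Icc 1 T, es t ^ 2 + C'
        + 2 * γ ^ 2 * ∑ t ∈ Finset.Icc 1 T, (φ t ⬝ᵥ (θ t - θ (t - 1))) ^ 2
        + 2 * (c₁ * Real.log T + c₂)) :
    limsup
      (fun T : ℕ => (1 / (T : ℝ)) *
        (∑ t ∈ Finset.Icc 1 T, e t ^ 2
          - 2 * (1 + γ) ^ 2 / (1 - γ) ^ 2 * ∑ t ∈ Finset.Icc 1 T, es t ^ 2))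
      atTop ≤ 0 := by
  have hstep : ∀ t : ℕ, (φ (t + 1) ⬝ᵥ (θ (t + 1) - θ t)) ^ 2 ≤
      Be ^ 2 / σn ^ 2 * ((S t).trace - (S (t + 1)).trace) := by
    intro t
    rw [hθrec t, add_sub_cancel_left]
    exact sq_dotProduct_gain_le_trace_sub hσn (hSpd t) (hSrec t)
      (by simpa using hres (t + 1) (by omega)) (Real.sqrt_le_one.mp (hφ (t + 1)))
  have hstab : ∀ T : ℕ, ∑ t ∈ Finset.Icc 1 T, (φ t ⬝ᵥ (θ t - θ (t - 1))) ^ 2 ≤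
      Be ^ 2 / σn ^ 2 * ((S 0).trace - (S T).trace) := by
    intro T
    induction T with
    | zero => simp
    | succ T ih =>
      rw [Finset.sum_Icc_succ_top (by omega), Nat.add_sub_cancel]
      linarith [hstep T]
  set M : ℝ := Be ^ 2 / σn ^ 2 * (S 0).trace
  have hM : ∀ T : ℕ, ∑ t ∈ Finset.Icc 1 T, (φ t ⬝ᵥ (θ t - θ (t - 1))) ^ 2 ≤ M := fun T =>
    (hstab T).trans (mul_le_mul_of_nonneg_left
      (sub_le_self _ (hSpd T).posSemidef.trace_nonneg) (by positivity))
  have hg : 0 < (1 - γ) ^ 2 := pow_pos (by linarith) 2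
  refine limsup_nonpos_of_eventually_le_of_tendsto_zero
    (g := fun T : ℕ => (C' + 2 * γ ^ 2 * M + 2 * c₂) / (1 - γ) ^ 2 * (1 / (T : ℝ)) +
      2 * c₁ / (1 - γ) ^ 2 * (Real.log T / T)) ?_ ?_
  · filter_upwards [eventually_ge_atTop 2] with T hT
    have hsum := mul_le_mul_of_nonneg_left (hM T) (by positivity : 0 ≤ 2 * γ ^ 2)
    have hmain := hineq T hT
    have hbound : ∑ t ∈ Finset.Icc 1 T, e t ^ 2
          - 2 * (1 + γ) ^ 2 / (1 - γ) ^ 2 * ∑ t ∈ Finset.Icc 1 T, es t ^ 2 ≤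
        (C' + 2 * γ ^ 2 * M + 2 * (c₁ * Real.log T + c₂)) / (1 - γ) ^ 2 := by
      rw [le_div_iff₀ hg, sub_mul, div_mul_eq_mul_div, div_mul_cancel₀ _ hg.ne']
      linarith
    refine (mul_le_mul_of_nonneg_left hbound (by positivity)).trans_eq ?_
    ring
  · have hlog : Tendsto (fun T : ℕ => Real.log T / (T : ℝ)) atTop (nhds 0) :=
      Real.isLittleO_log_id_atTop.tendsto_div_nhds_zero.comp tendsto_natCast_atTop_atTop
    simpa using (tendsto_one_div_atTop_nhds_zero_nat.const_mul
      ((C' + 2 * γ ^ 2 * M + 2 * c₂) / (1 - γ) ^ 2)).add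
      (hlog.const_mul (2 * c₁ / (1 - γ) ^ 2))
end
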